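/- There exists a unique probability distribution π on [a̲, ā] such that, for every initial state e₀ ∈ E and every initial value a₀ ∈ [a̲, ā], the distributions of a_t converge to π in the uniform metric d as t → ∞. Moreover, the interval [a̲, ā] is invariant: f(a,e) ∈ [a̲, ā] for all a ∈ [a̲, ā] and e ∈ E. -/

import Mathlib

open MeasureTheory ProbabilityTheory Set Filter Topology

/-- A time-homogeneous Markov chain on a finite state space `E` with one-step transition
probabilities `p`, characterised through the probabilities of finite words. -/
def IsMarkovChain {Ω E : Type*} [MeasurableSpace Ω] (Pr : Measure Ω)
    (p : E → E → ENNReal) (Z : ℕ → Ω → E) : Prop :=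
  ∀ (t : ℕ) (w : ℕ → E),
    Pr {ω | ∀ j ≤ t + 1, Z j ω = w j} =
      Pr {ω | ∀ j ≤ t, Z j ω = w j} * p (w t) (w (t + 1))

section Transition

variable {E : Type*} {p : E → E → ℝ} {f : ℝ → E → ℝ} {lo hi q : ℝ}

lemma foldl_mem_Icc (hf : ∀ a ∈ Icc lo hi, ∀ e, f a e ∈ Icc lo hi) (s : List E) :
    ∀ a ∈ Icc lo hi, s.foldl f a ∈ Icc lo hi := by
  induction s with
  | nil => exact fun a ha => ha
  | cons e s ih => exact fun a ha => ih _ (hf a ha e)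

lemma foldl_monotoneOn (hf : ∀ a ∈ Icc lo hi, ∀ e, f a e ∈ Icc lo hi)
    (hmono : ∀ e, MonotoneOn (fun a => f a e) (Icc lo hi)) (s : List E) :
    MonotoneOn (s.foldl f) (Icc lo hi) := by
  induction s with
  | nil => exact fun a _ b _ hab => hab
  | cons e s ih =>
    exact fun a ha b hb hab => ih (hf a ha e) (hf b hb e) (hmono e ha hb hab)

variable [Fintype E]

/-- The transition operator of the pair process `(a_t, e_t)` with `a_{t+1} = f (a_t, e_t)` and
`e_t` a Markov chain with transition probabilities `p`. -/
def transitionOp (p : E → E → ℝ) (f : ℝ → E → ℝ) (u : ℝ → E → ℝ) : ℝ → E → ℝ :=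
  fun a e => ∑ x, p e x * u (f a e) x

/-- The indicator of the states whose first coordinate is at most `r`. -/
noncomputable def belowIndicator (E : Type*) (r : ℝ) : ℝ → E → ℝ :=
  fun a _ => if a ≤ r then 1 else 0

lemma sub_transitionOp (hp_sum : ∀ e, ∑ e', p e e' = 1) (u : ℝ → E → ℝ) (M a : ℝ) (e : E) :
    M - transitionOp p f u a e = ∑ e', p e e' * (M - u (f a e) e') := by
  simp only [transitionOp, mul_sub, Finset.sum_sub_distrib, ← Finset.sum_mul, hp_sum, one_mul]

lemma transitionOp_neg (u : ℝ → E → ℝ) : transitionOp p f (-u) = -transitionOp p f u := by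
  ext a e
  simp [transitionOp]

lemma iterate_transitionOp_neg (u : ℝ → E → ℝ) (n : ℕ) :
    (transitionOp p f)^[n] (-u) = -(transitionOp p f)^[n] u := by
  induction n with
  | zero => rfl
  | succ n ih =>
    rw [Function.iterate_succ_apply', ih, transitionOp_neg, Function.iterate_succ_apply']

lemma transitionOp_le (hp : ∀ e e', 0 ≤ p e e') (hp_sum : ∀ e, ∑ e', p e e' = 1)
    (hf : ∀ a ∈ Icc lo hi, ∀ e, f a e ∈ Icc lo hi) {u : ℝ → E → ℝ} {M : ℝ}
    (hu : ∀ a ∈ Icc lo hi, ∀ e, u a e ≤ M) {a : ℝ} (ha : a ∈ Icc lo hi) (e : E) :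
    transitionOp p f u a e ≤ M := by
  rw [← sub_nonneg, sub_transitionOp hp_sum]
  exact Finset.sum_nonneg fun e' _ => mul_nonneg (hp e e') (sub_nonneg.2 (hu _ (hf a ha e) e'))

lemma iterate_transitionOp_le (hp : ∀ e e', 0 ≤ p e e') (hp_sum : ∀ e, ∑ e', p e e' = 1)
    (hf : ∀ a ∈ Icc lo hi, ∀ e, f a e ∈ Icc lo hi) {u : ℝ → E → ℝ} {M : ℝ}
    (hu : ∀ a ∈ Icc lo hi, ∀ e, u a e ≤ M) (n : ℕ) :
    ∀ a ∈ Icc lo hi, ∀ e, (transitionOp p f)^[n] u a e ≤ M := by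
  induction n with
  | zero => exact hu
  | succ n ih =>
    intro a ha e
    rw [Function.iterate_succ_apply']
    exact transitionOp_le hp hp_sum hf ih ha e

lemma le_iterate_transitionOp (hp : ∀ e e', 0 ≤ p e e') (hp_sum : ∀ e, ∑ e', p e e' = 1)
    (hf : ∀ a ∈ Icc lo hi, ∀ e, f a e ∈ Icc lo hi) {u : ℝ → E → ℝ} {m : ℝ}
    (hu : ∀ a ∈ Icc lo hi, ∀ e, m ≤ u a e) (n : ℕ) :
    ∀ a ∈ Icc lo hi, ∀ e, m ≤ (transitionOp p f)^[n] u a e := by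
  intro a ha e
  have := iterate_transitionOp_le (u := -u) (M := -m) hp hp_sum hf
    (fun a ha e => neg_le_neg (hu a ha e)) n a ha e
  rw [iterate_transitionOp_neg] at this
  exact neg_le_neg_iff.1 this

lemma iterate_transitionOp_antitoneOn (hp : ∀ e e', 0 ≤ p e e')
    (hf : ∀ a ∈ Icc lo hi, ∀ e, f a e ∈ Icc lo hi)
    (hmono : ∀ e, MonotoneOn (fun a => f a e) (Icc lo hi)) {u : ℝ → E → ℝ}
    (hu : ∀ e, AntitoneOn (fun a => u a e) (Icc lo hi)) (n : ℕ) :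
    ∀ e, AntitoneOn (fun a => (transitionOp p f)^[n] u a e) (Icc lo hi) := by
  induction n with
  | zero => exact hu
  | succ n ih =>
    intro e a ha b hb hab
    simp only [Function.iterate_succ_apply']
    exact Finset.sum_le_sum fun x _ => mul_le_mul_of_nonneg_left
      (ih x (hf a ha e) (hf b hb e) (hmono e ha hb hab)) (hp e x)

/-- If every transition has probability at least `q`, then following one prescribed word of
shocks improves an upper bound for the iterates of the transition operator. -/
lemma iterate_transitionOp_le_sub (hq : 0 ≤ q) (hpq : ∀ e e', q ≤ p e e')
    (hp_sum : ∀ e, ∑ e', p e e' = 1)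
    (hf : ∀ a ∈ Icc lo hi, ∀ e, f a e ∈ Icc lo hi) {u : ℝ → E → ℝ} {M : ℝ}
    (hu : ∀ a ∈ Icc lo hi, ∀ e, u a e ≤ M) (s : List E) (e₁ : E) :
    ∀ a ∈ Icc lo hi, ∀ e, (transitionOp p f)^[s.length + 1] u a e ≤
      M - q ^ (s.length + 1) * (M - u (s.foldl f (f a e)) e₁) := by
  have hp : ∀ e e', 0 ≤ p e e' := fun e e' => hq.trans (hpq e e')
  have step : ∀ v : ℝ → E → ℝ, (∀ a ∈ Icc lo hi, ∀ e, v a e ≤ M) → ∀ e', ∀ a ∈ Icc lo hi, ∀ e,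
      transitionOp p f v a e ≤ M - q * (M - v (f a e) e') := by
    intro v hv e' a ha e
    rw [le_sub_comm, sub_transitionOp hp_sum]
    have hnn : ∀ e', 0 ≤ M - v (f a e) e' := fun e' => sub_nonneg.2 (hv _ (hf a ha e) e')
    exact (mul_le_mul_of_nonneg_right (hpq e e') (hnn e')).trans
      (Finset.single_le_sum (f := fun e' => p e e' * (M - v (f a e) e'))
        (fun e' _ => mul_nonneg (hp e e') (hnn e')) (Finset.mem_univ e'))
  induction s with
  | nil => simpa using step u hu e₁
  | cons e' s ih =>
    intro a ha e
    rw [List.length_cons, Function.iterate_succ_apply', List.foldl_cons]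
    refine (step _ (iterate_transitionOp_le hp hp_sum hf hu _) e' a ha e).trans ?_
    have := mul_le_mul_of_nonneg_left (ih (f a e) (hf a ha e) e') hq
    rw [pow_succ']
    linarith

/-- If two words of the same length exchange the order of the endpoints, the corresponding iterate
of the transition operator contracts the oscillation of antitone functions. -/
lemma exists_bounds_iterate_transitionOp [Nonempty E] (hlohi : lo ≤ hi) (hq : 0 ≤ q)
    (hpq : ∀ e e', q ≤ p e e') (hp_sum : ∀ e, ∑ e', p e e' = 1)
    (hf : ∀ a ∈ Icc lo hi, ∀ e, f a e ∈ Icc lo hi)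
    (hmono : ∀ e, MonotoneOn (fun a => f a e) (Icc lo hi)) {s s' : List E}
    (hlen : s'.length = s.length) (hss' : s'.foldl f hi ≤ s.foldl f lo)
    {u : ℝ → E → ℝ} (hanti : ∀ e, AntitoneOn (fun a => u a e) (Icc lo hi)) {m M : ℝ}
    (hm : ∀ a ∈ Icc lo hi, ∀ e, m ≤ u a e) (hM : ∀ a ∈ Icc lo hi, ∀ e, u a e ≤ M) :
    ∃ m' M', M' - m' ≤ (1 - q ^ (s.length + 1)) * (M - m) ∧ ∀ a ∈ Icc lo hi, ∀ e,
      m' ≤ (transitionOp p f)^[s.length + 1] u a e ∧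
        (transitionOp p f)^[s.length + 1] u a e ≤ M' := by
  obtain ⟨e₁⟩ := ‹Nonempty E›
  set δ := q ^ (s.length + 1) with hδ
  have hδ0 : 0 ≤ δ := pow_nonneg hq _
  have hlo : lo ∈ Icc lo hi := left_mem_Icc.2 hlohi
  have hhi : hi ∈ Icc lo hi := right_mem_Icc.2 hlohi
  refine ⟨m + δ * (u (s'.foldl f hi) e₁ - m), M - δ * (M - u (s.foldl f lo) e₁), ?_,
    fun a ha e => ⟨?_, ?_⟩⟩
  · have := mul_le_mul_of_nonneg_left (hanti e₁ (foldl_mem_Icc hf s' hi hhi)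
      (foldl_mem_Icc hf s lo hlo) hss') hδ0
    dsimp only at this
    linarith
  · have h := iterate_transitionOp_le_sub (u := -u) (M := -m) hq hpq hp_sum hf
      (fun a ha e => neg_le_neg (hm a ha e)) s' e₁ a ha e
    rw [iterate_transitionOp_neg, hlen, ← hδ] at h
    have hfa := hf a ha e
    have := mul_le_mul_of_nonneg_left (hanti e₁ (foldl_mem_Icc hf s' _ hfa)
      (foldl_mem_Icc hf s' hi hhi) (foldl_monotoneOn hf hmono s' hfa hhi hfa.2)) hδ0
    simp only [Pi.neg_apply] at h this
    linarith
  · have h := iterate_transitionOp_le_sub hq hpq hp_sum hf hM s e₁ a ha e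
    have hfa := hf a ha e
    have := mul_le_mul_of_nonneg_left (hanti e₁ (foldl_mem_Icc hf s lo hlo)
      (foldl_mem_Icc hf s _ hfa) (foldl_monotoneOn hf hmono s hlo hfa hfa.1)) hδ0
    rw [← hδ] at h
    dsimp only at this
    linarith

/-- If below `hi` some shock always moves the state up, then words of shocks bring the state from
`lo` arbitrarily close to `hi`. -/
lemma eventually_exists_lt_foldl [Nonempty E] (hlohi : lo ≤ hi)
    (hf : ∀ a ∈ Icc lo hi, ∀ e, f a e ∈ Icc lo hi)
    (hmono : ∀ e, MonotoneOn (fun a => f a e) (Icc lo hi))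
    (hcont : ∀ e, ContinuousOn (fun a => f a e) (Icc lo hi))
    (hup : ∀ a ∈ Icc lo hi, a < hi → ∃ e, a < f a e) {c : ℝ} (hc : c < hi) :
    ∀ᶠ n in atTop, ∃ s : List E, s.length = n ∧ c < s.foldl f lo := by
  have hhi : hi ∈ Icc lo hi := right_mem_Icc.2 hlohi
  have hup' : ∀ a ∈ Icc lo hi, ∃ e, a ≤ f a e := by
    intro a ha
    rcases ha.2.lt_or_eq with h | rfl
    · obtain ⟨e, he⟩ := hup a ha h
      exact ⟨e, he.le⟩
    · by_contra! hcon
      obtain ⟨e₀, he₀⟩ := Finite.exists_max (f a)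
      obtain ⟨e, he⟩ := hup _ (hf a ha e₀) (hcon e₀)
      exact (he.trans_le (hmono e (hf a ha e₀) ha (hcon e₀).le)).not_ge (he₀ e)
  choose g hg using fun a => Finite.exists_max (f a)
  let y : ℕ → ℝ := fun n => (fun a => f a (g a))^[n] lo
  have hy : ∀ n, y (n + 1) = f (y n) (g (y n)) := fun n => Function.iterate_succ_apply' _ _ _
  have hymem : ∀ n, y n ∈ Icc lo hi := by
    intro n
    induction n with
    | zero => exact left_mem_Icc.2 hlohi
    | succ n ih => rw [hy]; exact hf _ ih _
  have hyword : ∀ n, ∃ s : List E, s.length = n ∧ s.foldl f lo = y n := by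
    intro n
    induction n with
    | zero => exact ⟨[], rfl, rfl⟩
    | succ n ih =>
      obtain ⟨s, hs, hsy⟩ := ih
      exact ⟨s ++ [g (y n)], by simp [hs], by simp [hsy, hy]⟩
  have hymono : Monotone y := by
    refine monotone_nat_of_le_succ fun n => ?_
    obtain ⟨e, he⟩ := hup' (y n) (hymem n)
    rw [hy]
    exact he.trans (hg _ e)
  obtain ⟨L, hL⟩ : ∃ L, Tendsto y atTop (𝓝 L) :=
    ⟨_, tendsto_atTop_ciSup hymono ⟨hi, by rintro _ ⟨n, rfl⟩; exact (hymem n).2⟩⟩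
  have hLmem : L ∈ Icc lo hi := isClosed_Icc.mem_of_tendsto hL (Eventually.of_forall hymem)
  have hLhi : L = hi := by
    refine hLmem.2.eq_of_not_lt fun hlt => ?_
    obtain ⟨e, he⟩ := hup L hLmem hlt
    have h1 : Tendsto (fun n => f (y n) e) atTop (𝓝 (f L e)) :=
      (hcont e L hLmem).tendsto.comp
        (tendsto_nhdsWithin_iff.2 ⟨hL, Eventually.of_forall hymem⟩)
    refine he.not_ge (le_of_tendsto_of_tendsto' h1 (hL.comp (tendsto_add_atTop_nat 1)) fun n => ?_)
    rw [Function.comp_apply, hy]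
    exact hg _ e
  filter_upwards [hL.eventually (lt_mem_nhds (hLhi ▸ hc))] with n hn
  obtain ⟨s, hs, hsy⟩ := hyword n
  exact ⟨s, hs, hsy ▸ hn⟩

lemma eventually_exists_foldl_lt [Nonempty E] (hlohi : lo ≤ hi)
    (hf : ∀ a ∈ Icc lo hi, ∀ e, f a e ∈ Icc lo hi)
    (hmono : ∀ e, MonotoneOn (fun a => f a e) (Icc lo hi))
    (hcont : ∀ e, ContinuousOn (fun a => f a e) (Icc lo hi))
    (hdown : ∀ a ∈ Icc lo hi, lo < a → ∃ e, f a e < a) {c : ℝ} (hc : lo < c) :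
    ∀ᶠ n in atTop, ∃ s : List E, s.length = n ∧ s.foldl f hi < c := by
  have hneg : ∀ a ∈ Icc (-hi) (-lo), -a ∈ Icc lo hi := fun a ha =>
    ⟨le_neg_of_le_neg ha.2, neg_le.1 ha.1⟩
  have hfold : ∀ (s : List E) (a : ℝ), s.foldl (fun a e => -f (-a) e) a = -s.foldl f (-a) := by
    intro s
    induction s with
    | nil => simp
    | cons e s ih => intro a; simp [ih]
  have key := eventually_exists_lt_foldl (E := E) (f := fun a e => -f (-a) e) (lo := -hi)
    (hi := -lo) (c := -c) (neg_le_neg hlohi)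
    (fun a ha e => ⟨neg_le_neg (hf _ (hneg a ha) e).2, neg_le_neg (hf _ (hneg a ha) e).1⟩)
    (fun e a ha b hb hab => neg_le_neg (hmono e (hneg b hb) (hneg a ha) (neg_le_neg hab)))
    (fun e => ((hcont e).comp continuousOn_neg hneg).neg)
    (fun a ha hlt => (hdown (-a) (hneg a ha) (lt_neg_of_lt_neg hlt)).imp
      fun e he => lt_neg_of_lt_neg he)
    (neg_lt_neg hc)
  filter_upwards [key] with n ⟨s, hs, hlt⟩
  refine ⟨s, hs, ?_⟩
  rwa [hfold, neg_neg, neg_lt_neg_iff] at hlt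

lemma exists_foldl_le_foldl [Nonempty E] (hlohi : lo ≤ hi)
    (hf : ∀ a ∈ Icc lo hi, ∀ e, f a e ∈ Icc lo hi)
    (hmono : ∀ e, MonotoneOn (fun a => f a e) (Icc lo hi))
    (hcont : ∀ e, ContinuousOn (fun a => f a e) (Icc lo hi))
    (hup : ∀ a ∈ Icc lo hi, a < hi → ∃ e, a < f a e)
    (hdown : ∀ a ∈ Icc lo hi, lo < a → ∃ e, f a e < a) :
    ∃ s s' : List E, s'.length = s.length ∧ s'.foldl f hi ≤ s.foldl f lo := by
  rcases hlohi.eq_or_lt with rfl | hlt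
  · exact ⟨[], [], rfl, le_rfl⟩
  · obtain ⟨c, hlc, hch⟩ := exists_between hlt
    obtain ⟨n, ⟨s, hs, hsc⟩, s', hs', hsc'⟩ :=
      ((eventually_exists_lt_foldl hlohi hf hmono hcont hup hch).and
        (eventually_exists_foldl_lt hlohi hf hmono hcont hdown hlc)).exists
    exact ⟨s, s', hs'.trans hs.symm, (hsc'.trans hsc).le⟩

/-- Uniform forgetting of the initial state. -/
lemma exists_abs_iterate_transitionOp_sub_le [Nonempty E] (hlohi : lo ≤ hi)
    (hp : ∀ e e', 0 < p e e') (hp_sum : ∀ e, ∑ e', p e e' = 1)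
    (hf : ∀ a ∈ Icc lo hi, ∀ e, f a e ∈ Icc lo hi)
    (hmono : ∀ e, MonotoneOn (fun a => f a e) (Icc lo hi))
    (hcont : ∀ e, ContinuousOn (fun a => f a e) (Icc lo hi))
    (hup : ∀ a ∈ Icc lo hi, a < hi → ∃ e, a < f a e)
    (hdown : ∀ a ∈ Icc lo hi, lo < a → ∃ e, f a e < a) {ε : ℝ} (hε : 0 < ε) :
    ∃ t₀ : ℕ, ∀ t ≥ t₀, ∀ t' ≥ t₀, ∀ a ∈ Icc lo hi, ∀ a' ∈ Icc lo hi, ∀ (e e' : E) (r : ℝ),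
      |(transitionOp p f)^[t] (belowIndicator E r) a e -
        (transitionOp p f)^[t'] (belowIndicator E r) a' e'| ≤ ε := by
  obtain ⟨s, s', hlen, hss'⟩ := exists_foldl_le_foldl hlohi hf hmono hcont hup hdown
  obtain ⟨⟨x, y⟩, hxy⟩ := Finite.exists_min fun x : E × E => p x.1 x.2
  set q := p x y
  have hq : 0 < q := hp x y
  have hpq : ∀ e e', q ≤ p e e' := fun e e' => hxy (e, e')
  have hp0 : ∀ e e', 0 ≤ p e e' := fun e e' => (hp e e').le
  have hq1 : q ≤ 1 := by
    rw [← hp_sum x]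
    exact Finset.single_le_sum (fun e' _ => hp0 x e') (Finset.mem_univ y)
  set n := s.length + 1
  set ρ := 1 - q ^ n
  have hρ0 : 0 ≤ ρ := sub_nonneg.2 (pow_le_one₀ hq.le hq1)
  have hρ1 : ρ < 1 := sub_lt_self _ (pow_pos hq n)
  have hanti : ∀ (r : ℝ) (e : E),
      AntitoneOn (fun a => belowIndicator E r a e) (Icc lo hi) := by
    intro r e a _ b _ hab
    simp only [belowIndicator]
    split_ifs <;> linarith
  have bounds : ∀ r k, ∃ m M : ℝ, M - m ≤ ρ ^ k ∧ ∀ a ∈ Icc lo hi, ∀ e,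
      m ≤ (transitionOp p f)^[n * k] (belowIndicator E r) a e ∧
        (transitionOp p f)^[n * k] (belowIndicator E r) a e ≤ M := by
    intro r k
    induction k with
    | zero =>
      refine ⟨0, 1, by simp, fun a _ e => ?_⟩
      simp only [mul_zero, Function.iterate_zero, id_eq, belowIndicator]
      split_ifs <;> norm_num
    | succ k ih =>
      obtain ⟨m, M, hmM, hb⟩ := ih
      obtain ⟨m', M', hmM', hb'⟩ := exists_bounds_iterate_transitionOp hlohi hq.le hpq hp_sum hf
        hmono hlen hss' (iterate_transitionOp_antitoneOn hp0 hf hmono (hanti r) (n * k))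
        (fun a ha e => (hb a ha e).1) (fun a ha e => (hb a ha e).2)
      refine ⟨m', M', hmM'.trans ?_, ?_⟩
      · rw [pow_succ' ρ]
        exact mul_le_mul_of_nonneg_left hmM hρ0
      · rwa [mul_add_one, add_comm, Function.iterate_add]
  obtain ⟨k, hk⟩ := exists_pow_lt_of_lt_one hε hρ1
  refine ⟨n * k, fun t ht t' ht' a ha a' ha' e e' r => ?_⟩
  obtain ⟨m, M, hmM, hb⟩ := bounds r k
  have hb' : ∀ t ≥ n * k, ∀ a ∈ Icc lo hi, ∀ e,
      (transitionOp p f)^[t] (belowIndicator E r) a e ∈ Icc m M := by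
    intro t ht a ha e
    obtain ⟨j, rfl⟩ := Nat.exists_eq_add_of_le' ht
    rw [Function.iterate_add, Function.comp_apply]
    exact ⟨le_iterate_transitionOp hp0 hp_sum hf (fun a ha e => (hb a ha e).1) j a ha e,
      iterate_transitionOp_le hp0 hp_sum hf (fun a ha e => (hb a ha e).2) j a ha e⟩
  have h := hb' t ht a ha e
  have h' := hb' t' ht' a' ha' e'
  rw [abs_le]
  constructor <;> linarith [h.1, h.2, h'.1, h'.2]

lemma iterate_transitionOp_belowIndicator_mono (hp : ∀ e e', 0 ≤ p e e') (t : ℕ) :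
    ∀ (a : ℝ) (e : E), Monotone fun r => (transitionOp p f)^[t] (belowIndicator E r) a e := by
  induction t with
  | zero =>
    intro a e r r' hrr'
    simp only [Function.iterate_zero, id_eq, belowIndicator]
    split_ifs <;> linarith
  | succ t ih =>
    intro a e r r' hrr'
    simp only [Function.iterate_succ_apply']
    exact Finset.sum_le_sum fun e' _ => mul_le_mul_of_nonneg_left (ih _ _ hrr') (hp e e')

lemma continuousWithinAt_iterate_transitionOp_belowIndicator (r : ℝ) (t : ℕ) :
    ∀ (a : ℝ) (e : E), ContinuousWithinAt
      (fun r => (transitionOp p f)^[t] (belowIndicator E r) a e) (Ici r) r := by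
  induction t with
  | zero =>
    intro a e
    simp only [Function.iterate_zero, id_eq, belowIndicator]
    by_cases h : a ≤ r
    · exact (continuousWithinAt_const (b := (1 : ℝ))).congr
        (fun x hx => if_pos (h.trans hx)) (if_pos h)
    · refine ContinuousAt.continuousWithinAt ?_
      refine continuousAt_const.congr (f := fun _ => 0) ?_
      filter_upwards [gt_mem_nhds (not_le.1 h)] with x hx
      exact (if_neg hx.not_ge).symm
  | succ t ih =>
    intro a e
    simp only [Function.iterate_succ_apply', transitionOp]
    exact tendsto_finsetSum _ fun e' _ => (ih _ _).const_mul _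

/-- The distribution functions of the first coordinate converge, uniformly in the argument and in
the initial state, to the distribution function of a probability measure. -/
lemma exists_measure_iterate_transitionOp [Nonempty E] (hlohi : lo ≤ hi)
    (hp : ∀ e e', 0 < p e e') (hp_sum : ∀ e, ∑ e', p e e' = 1)
    (hf : ∀ a ∈ Icc lo hi, ∀ e, f a e ∈ Icc lo hi)
    (hmono : ∀ e, MonotoneOn (fun a => f a e) (Icc lo hi))
    (hcont : ∀ e, ContinuousOn (fun a => f a e) (Icc lo hi))
    (hup : ∀ a ∈ Icc lo hi, a < hi → ∃ e, a < f a e)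
    (hdown : ∀ a ∈ Icc lo hi, lo < a → ∃ e, f a e < a) :
    ∃ π : Measure ℝ, IsProbabilityMeasure π ∧ π (Icc lo hi) = 1 ∧
      ∀ ε > (0 : ℝ), ∃ t₀ : ℕ, ∀ t ≥ t₀, ∀ a ∈ Icc lo hi, ∀ (e : E) (r : ℝ),
        |(transitionOp p f)^[t] (belowIndicator E r) a e - (π (Iic r)).toReal| ≤ ε := by
  have hforget := fun ε (hε : (0 : ℝ) < ε) =>
    exists_abs_iterate_transitionOp_sub_le hlohi hp hp_sum hf hmono hcont hup hdown hε
  have hp0 : ∀ e e', 0 ≤ p e e' := fun e e' => (hp e e').le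
  have hlo : lo ∈ Icc lo hi := left_mem_Icc.2 hlohi
  obtain ⟨e₀⟩ := id ‹Nonempty E›
  have hlim : ∀ r, ∃ l, Tendsto (fun t => (transitionOp p f)^[t] (belowIndicator E r) lo e₀)
      atTop (𝓝 l) := by
    refine fun r => cauchySeq_tendsto_of_complete (Metric.cauchySeq_iff.2 fun ε hε => ?_)
    obtain ⟨t₀, ht₀⟩ := hforget (ε / 2) (half_pos hε)
    exact ⟨t₀, fun t ht t' ht' =>
      (ht₀ t ht t' ht' lo hlo lo hlo e₀ e₀ r).trans_lt (half_lt_self hε)⟩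
  choose F hF using hlim
  have hconv : ∀ ε > (0 : ℝ), ∃ t₀ : ℕ, ∀ t ≥ t₀, ∀ a ∈ Icc lo hi, ∀ (e : E) (r : ℝ),
      |(transitionOp p f)^[t] (belowIndicator E r) a e - F r| ≤ ε := by
    intro ε hε
    obtain ⟨t₀, ht₀⟩ := hforget ε hε
    refine ⟨t₀, fun t ht a ha e r => ?_⟩
    refine le_of_tendsto ((tendsto_const_nhds.sub (hF r)).abs) ?_
    filter_upwards [eventually_ge_atTop t₀] with t' ht'
    exact ht₀ t ht t' ht' a ha lo hlo e e₀ r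
  have hFmono : Monotone F := fun r r' hrr' => le_of_tendsto_of_tendsto' (hF r) (hF r') fun t =>
    iterate_transitionOp_belowIndicator_mono hp0 t lo e₀ hrr'
  have hFcont : ∀ r, ContinuousWithinAt F (Ici r) r := by
    refine fun r => continuousWithinAt_of_locally_uniform_approx_of_continuousWithinAt
      self_mem_Ici fun U hU => ?_
    obtain ⟨ε, hε, hεU⟩ := Metric.mem_uniformity_dist.1 hU
    obtain ⟨t₀, ht₀⟩ := hconv (ε / 2) (half_pos hε)
    refine ⟨_, self_mem_nhdsWithin, _,
      continuousWithinAt_iterate_transitionOp_belowIndicator (p := p) (f := f) r t₀ lo e₀,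
      fun y _ => hεU ?_⟩
    rw [dist_comm, Real.dist_eq]
    exact (ht₀ t₀ le_rfl lo hlo e₀ y).trans_lt (half_lt_self hε)
  have hF0 : ∀ r < lo, F r = 0 := by
    intro r hr
    refine tendsto_nhds_unique (hF r) (tendsto_const_nhds.congr fun t => le_antisymm ?_ ?_)
    · refine le_iterate_transitionOp hp0 hp_sum hf (fun a _ e => ?_) t lo hlo e₀
      simp only [belowIndicator]
      split_ifs <;> norm_num
    · refine iterate_transitionOp_le hp0 hp_sum hf (fun a ha e => ?_) t lo hlo e₀
      exact (if_neg (hr.trans_le ha.1).not_ge).le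
  have hF1 : ∀ r ≥ hi, F r = 1 := by
    intro r hr
    refine tendsto_nhds_unique (hF r) (tendsto_const_nhds.congr fun t => le_antisymm ?_ ?_)
    · refine le_iterate_transitionOp hp0 hp_sum hf (fun a ha e => ?_) t lo hlo e₀
      exact (if_pos (ha.2.trans hr)).ge
    · refine iterate_transitionOp_le hp0 hp_sum hf (fun a _ e => ?_) t lo hlo e₀
      simp only [belowIndicator]
      split_ifs <;> norm_num
  let G : StieltjesFunction ℝ := ⟨F, hFmono, hFcont⟩
  have hbot : Tendsto G atBot (𝓝 0) := tendsto_const_nhds.congr' <| by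
    filter_upwards [eventually_lt_atBot lo] with r hr using (hF0 r hr).symm
  have htop : Tendsto G atTop (𝓝 1) := tendsto_const_nhds.congr' <| by
    filter_upwards [eventually_ge_atTop hi] with r hr using (hF1 r hr).symm
  have hleft : Function.leftLim G lo = 0 := by
    refine leftLim_eq_of_tendsto (tendsto_const_nhds.congr' ?_)
    filter_upwards [self_mem_nhdsWithin] with r hr using (hF0 r hr).symm
  refine ⟨G.measure, G.isProbabilityMeasure hbot htop, ?_, ?_⟩
  · rw [G.measure_Icc, hleft, show G hi = 1 from hF1 hi le_rfl]
    simp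
  · have hG : ∀ r, (G.measure (Iic r)).toReal = F r := by
      intro r
      rw [G.measure_Iic hbot, sub_zero]
      refine ENNReal.toReal_ofReal ?_
      exact le_of_tendsto hbot ((eventually_le_atBot r).mono fun x hx => hFmono hx)
    simpa only [hG] using hconv

end Transition

section Chain

variable {Ω E : Type*} [MeasurableSpace Ω] [Fintype E] [MeasurableSpace E]
  [MeasurableSingletonClass E] {p : E → E → ENNReal}

/-- After the chain has followed a word, the conditional distribution function of the asset process
is given by the iterates of the transition operator. -/
lemma IsMarkovChain.measureReal_word_inter_le {Pr : Measure Ω} [IsFiniteMeasure Pr]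
    {Z : ℕ → Ω → E} (hM : IsMarkovChain Pr p Z) (hZ : ∀ t, Measurable (Z t))
    {f : ℝ → E → ℝ} {a : ℕ → Ω → ℝ} (ha : ∀ t ω, a (t + 1) ω = f (a t ω) (Z t ω))
    (r : ℝ) (t : ℕ) : ∀ (s : ℕ) (w : ℕ → E) (b : ℝ),
      (∀ ω, (∀ j ≤ s, Z j ω = w j) → a s ω = b) →
      Pr.real {ω | (∀ j ≤ s, Z j ω = w j) ∧ a (s + t) ω ≤ r} =
        Pr.real {ω | ∀ j ≤ s, Z j ω = w j} *
          (transitionOp (fun e e' => (p e e').toReal) f)^[t] (belowIndicator E r) b (w s) := by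
  classical
  induction t with
  | zero =>
    intro s w b hb
    simp only [add_zero, Function.iterate_zero, id_eq, belowIndicator]
    split_ifs with h
    · rw [mul_one]
      congr 1
      ext ω
      exact and_iff_left_of_imp fun hω => (hb ω hω).trans_le h
    · rw [mul_zero]
      convert measureReal_empty
      ext ω
      simp only [mem_ofPred_eq, mem_empty_iff_false, iff_false, not_and]
      exact fun hω => by rwa [hb ω hω]
  | succ t ih =>
    intro s w b hb
    set S := {ω | (∀ j ≤ s, Z j ω = w j) ∧ a (s + (t + 1)) ω ≤ r}
    have hsplit : Pr.real S = ∑ e', Pr.real (Z (s + 1) ⁻¹' {e'} ∩ S) := by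
      have h := sum_measureReal_preimage_singleton (μ := Pr.restrict S) Finset.univ
        (f := Z (s + 1)) fun y _ => hZ (s + 1) (measurableSet_singleton y)
      simp only [Finset.coe_univ, preimage_univ, measureReal_restrict_apply_univ] at h
      rw [← h]
      exact Finset.sum_congr rfl fun e' _ =>
        measureReal_restrict_apply (hZ (s + 1) (measurableSet_singleton e'))
    have hword : ∀ (e' : E) (ω : Ω), (∀ j ≤ s + 1, Z j ω = Function.update w (s + 1) e' j) ↔
        Z (s + 1) ω = e' ∧ ∀ j ≤ s, Z j ω = w j := by
      intro e' ω
      constructor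
      · refine fun h => ⟨by simpa using h (s + 1) le_rfl, fun j hj => ?_⟩
        rw [h j (by lia), Function.update_of_ne (by lia)]
      · rintro ⟨h, h'⟩ j hj
        rcases hj.eq_or_lt with rfl | hj
        · simpa using h
        · rw [h' j (by lia), Function.update_of_ne (by lia)]
    have hterm : ∀ e', Pr.real (Z (s + 1) ⁻¹' {e'} ∩ S) =
        Pr.real {ω | ∀ j ≤ s, Z j ω = w j} * ((p (w s) e').toReal *
          (transitionOp (fun e e' => (p e e').toReal) f)^[t] (belowIndicator E r)
            (f b (w s)) e') := by
      intro e'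
      have h1 := ih (s + 1) (Function.update w (s + 1) e') (f b (w s)) fun ω hω => by
        have hω' := ((hword e' ω).1 hω).2
        rw [ha, hb ω hω', hω' s le_rfl]
      have h2 := congrArg ENNReal.toReal (hM s (Function.update w (s + 1) e'))
      have h3 : {ω | ∀ j ≤ s, Z j ω = Function.update w (s + 1) e' j} =
          {ω | ∀ j ≤ s, Z j ω = w j} := by
        ext ω
        refine forall₂_congr fun j hj => ?_
        rw [Function.update_of_ne (by lia)]
      rw [h3, ENNReal.toReal_mul, Function.update_self, Function.update_of_ne (by lia)] at h2
      simp only [measureReal_def] at h1 ⊢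
      rw [h2, Function.update_self] at h1
      rw [← mul_assoc, ← h1]
      congr 2
      ext ω
      simp only [S, mem_inter_iff, mem_preimage, mem_singleton_iff, mem_ofPred_eq, hword,
        and_assoc, add_assoc, add_comm t 1]
    rw [hsplit, Finset.sum_congr rfl fun e' _ => hterm e', ← Finset.mul_sum,
      Function.iterate_succ_apply']
    rfl

lemma IsMarkovChain.measureReal_le_eq_iterate {Pr : Measure Ω} [IsProbabilityMeasure Pr]
    {Z : ℕ → Ω → E} (hM : IsMarkovChain Pr p Z) (hZ : ∀ t, Measurable (Z t))
    {e₀ : E} (he₀ : Pr {ω | Z 0 ω = e₀} = 1)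
    {f : ℝ → E → ℝ} {a : ℕ → Ω → ℝ} {a₀ : ℝ} (ha₀ : ∀ ω, a 0 ω = a₀)
    (ha : ∀ t ω, a (t + 1) ω = f (a t ω) (Z t ω)) (t : ℕ) (r : ℝ) :
    Pr.real {ω | a t ω ≤ r} =
      (transitionOp (fun e e' => (p e e').toReal) f)^[t] (belowIndicator E r) a₀ e₀ := by
  have h := hM.measureReal_word_inter_le hZ ha r t 0 (fun _ => e₀) a₀ fun ω _ => ha₀ ω
  simp only [nonpos_iff_eq_zero, forall_eq, zero_add, measureReal_def, he₀, ENNReal.toReal_one,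
    one_mul] at h
  have hae : ∀ᵐ ω ∂Pr, Z 0 ω = e₀ :=
    mem_ae_iff_prob_eq_one (hZ 0 (measurableSet_singleton e₀)) |>.2 he₀
  rw [← h, measureReal_def]
  congr 1
  refine measure_congr ?_
  filter_upwards [hae] with ω hω
  exact propext (and_iff_right hω).symm

end Chain

/-- The path, started at `e₀`, generated by a sequence of maps of the state space. -/
def pathOfMaps {E : Type*} (e₀ : E) : ℕ → (ℕ → E → E) → E
  | 0, _ => e₀
  | t + 1, ω => ω t (pathOfMaps e₀ t ω)

lemma forall_pathOfMaps_eq_iff {E : Type*} (e₀ : E) (w : ℕ → E) (t : ℕ) (ω : ℕ → E → E) :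
    (∀ j ≤ t, pathOfMaps e₀ j ω = w j) ↔ e₀ = w 0 ∧ ∀ j < t, ω j (w j) = w (j + 1) := by
  induction t with
  | zero => simp [pathOfMaps]
  | succ t ih =>
    rw [Nat.forall_lt_succ_right, ← and_assoc, ← ih]
    constructor
    · intro h
      refine ⟨fun j hj => h j (by lia), ?_⟩
      rw [← h t (by lia)]
      exact h (t + 1) le_rfl
    · rintro ⟨h, h'⟩ j hj
      rcases hj.eq_or_lt with rfl | hj
      · rw [← h', ← h t le_rfl]
        rfl
      · exact h j (by lia)

/-- Every stochastic matrix on a finite state space has a Markov chain with a prescribed initial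
state. -/
lemma exists_isMarkovChain {E : Type*} [Fintype E] [MeasurableSpace E]
    [MeasurableSingletonClass E] (p : E → E → ENNReal) (hp_sum : ∀ e, ∑ e', p e e' = 1) (e₀ : E) :
    ∃ (Pr : Measure (ℕ → E → E)) (Z : ℕ → (ℕ → E → E) → E), IsProbabilityMeasure Pr ∧
      (∀ t, Measurable (Z t)) ∧ IsMarkovChain Pr p Z ∧ Pr {ω | Z 0 ω = e₀} = 1 := by
  classical
  let ν : E → Measure E := fun e => (PMF.ofFintype (p e) (hp_sum e)).toMeasure
  have hν : ∀ e, IsProbabilityMeasure (ν e) := fun e => PMF.toMeasure.isProbabilityMeasure _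
  let κ : Measure (E → E) := Measure.pi ν
  have hκ : ∀ e e', κ {g | g e = e'} = p e e' := by
    intro e e'
    have h := (measurePreserving_eval ν e).measure_preimage
      (measurableSet_singleton e').nullMeasurableSet
    simp only [ν, PMF.toMeasure_apply_singleton _ _ (measurableSet_singleton e'),
      PMF.ofFintype_apply] at h
    exact h
  have hword : ∀ (t : ℕ) (w : ℕ → E),
      Measure.infinitePi (fun _ : ℕ => κ) {ω | ∀ j ≤ t, pathOfMaps e₀ j ω = w j} =
        (if e₀ = w 0 then 1 else 0) * ∏ j ∈ Finset.range t, p (w j) (w (j + 1)) := by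
    intro t w
    simp only [forall_pathOfMaps_eq_iff]
    split_ifs with h
    · have h' := Measure.infinitePi_pi (fun _ : ℕ => κ) (s := Finset.range t)
        (t := fun j => {g | g (w j) = w (j + 1)}) fun j _ =>
          measurableSet_eq_fun (measurable_pi_apply (w j)) measurable_const
      simp only [hκ] at h'
      rw [one_mul, ← h']
      congr 1
      ext ω
      simp [h, Set.mem_pi]
    · simp [h]
  refine ⟨Measure.infinitePi fun _ => κ, pathOfMaps e₀, inferInstance, fun t => ?_, fun t w => ?_,
    by simp [pathOfMaps]⟩
  · induction t with
    | zero => exact measurable_const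
    | succ t ih =>
      refine measurable_to_countable' fun e' => ?_
      have : pathOfMaps e₀ (t + 1) ⁻¹' {e'} =
          ⋃ e, pathOfMaps e₀ t ⁻¹' {e} ∩ (fun ω : ℕ → E → E => ω t e) ⁻¹' {e'} := by
        ext ω
        simp [pathOfMaps]
      rw [this]
      exact MeasurableSet.iUnion fun e => (ih (measurableSet_singleton e)).inter
        ((measurable_pi_apply e).comp (measurable_pi_apply t) (measurableSet_singleton e'))
  · rw [hword, hword, Finset.prod_range_succ, mul_assoc]

/-- **stability in the Huggett model.**  Let `{e_t}` be a finite-state Markov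
chain with all transition probabilities positive, and `f : [a̲,∞) × E → [a̲,∞)` continuous
and nondecreasing in its first argument such that (i) for every `a > a̲` some state moves
assets down, and (ii) beyond some `â` all states move assets down.  With
`ā = min{a ≥ a̲ : f(a,e) ≤ a for all e}`, the interval `[a̲, ā]` is invariant, and there is
a unique probability distribution `π` on `[a̲, ā]` such that for every initial state
`e₀ ∈ E` and every initial value `a₀ ∈ [a̲, ā]` the distributions of the asset process
`a_{t+1} = f(a_t, e_t)` converge to `π` in the uniform metric. -/
theorem stmt12
    {E : Type} [Fintype E] [Nonempty E] [MeasurableSpace E] [MeasurableSingletonClass E]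
    (p : E → E → ENNReal) (hp_pos : ∀ e e', 0 < p e e') (hp_sum : ∀ e, ∑ e', p e e' = 1)
    (abot : ℝ) (f : ℝ → E → ℝ)
    (hf_range : ∀ a : ℝ, abot ≤ a → ∀ e, abot ≤ f a e)
    (hf_cont : ∀ e, ContinuousOn (fun a => f a e) (Ici abot))
    (hf_mono : ∀ e, MonotoneOn (fun a => f a e) (Ici abot))
    (h_i : ∀ a : ℝ, abot < a → ∃ e, f a e < a)
    (h_ii : ∃ ahat : ℝ, abot ≤ ahat ∧ ∀ a : ℝ, ahat < a → ∀ e, f a e < a)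
    (abar : ℝ) (habar : IsLeast {a : ℝ | abot ≤ a ∧ ∀ e, f a e ≤ a} abar) :
    (∀ a ∈ Icc abot abar, ∀ e : E, f a e ∈ Icc abot abar) ∧
    ∃! π : Measure ℝ, IsProbabilityMeasure π ∧ π (Icc abot abar) = 1 ∧
      ∀ (Ω : Type) [MeasurableSpace Ω] (Pr : Measure Ω), IsProbabilityMeasure Pr →
      ∀ (Z : ℕ → Ω → E), (∀ t, Measurable (Z t)) → IsMarkovChain Pr p Z →
      ∀ e₀ : E, Pr {ω | Z 0 ω = e₀} = 1 →
      ∀ a₀ ∈ Icc abot abar,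
      ∀ (a : ℕ → Ω → ℝ), (∀ ω, a 0 ω = a₀) →
        (∀ t ω, a (t + 1) ω = f (a t ω) (Z t ω)) →
      ∀ ε > (0:ℝ), ∃ t₀ : ℕ, ∀ t ≥ t₀, ∀ r : ℝ,
        |(Pr {ω | a t ω ≤ r}).toReal - (π (Iic r)).toReal| ≤ ε := by
  have hinv : ∀ a ∈ Icc abot abar, ∀ e : E, f a e ∈ Icc abot abar := fun a ha e =>
    ⟨hf_range a ha.1 e, (hf_mono e ha.1 habar.1.1 ha.2).trans (habar.1.2 e)⟩
  have hp_le : ∀ e e', p e e' ≤ 1 := fun e e' =>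
    (Finset.single_le_sum (fun _ _ => zero_le) (Finset.mem_univ e')).trans_eq (hp_sum e)
  have hp_top : ∀ e e', p e e' ≠ ⊤ := fun e e' =>
    ne_top_of_le_ne_top ENNReal.one_ne_top (hp_le e e')
  obtain ⟨π, hπ, hπ_Icc, hconv⟩ := exists_measure_iterate_transitionOp
    (p := fun e e' => (p e e').toReal) habar.1.1
    (fun e e' => ENNReal.toReal_pos (hp_pos e e').ne' (hp_top e e'))
    (fun e => by
      rw [← ENNReal.toReal_sum fun e' _ => hp_top e e', hp_sum, ENNReal.toReal_one])
    hinv (fun e => (hf_mono e).mono Icc_subset_Ici_self)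
    (fun e => (hf_cont e).mono Icc_subset_Ici_self)
    (fun a ha hlt => by
      by_contra! hcon
      exact hlt.not_ge (habar.2 ⟨ha.1, hcon⟩))
    (fun a _ hlt => h_i a hlt)
  refine ⟨hinv, π, ⟨hπ, hπ_Icc, ?_⟩, ?_⟩
  · intro Ω _ Pr hPr Z hZ hM e₀ he₀ a₀ ha₀ a ha0 ha ε hε
    obtain ⟨t₀, ht₀⟩ := hconv ε hε
    refine ⟨t₀, fun t ht r => ?_⟩
    rw [← measureReal_def, hM.measureReal_le_eq_iterate hZ he₀ ha0 ha]
    exact ht₀ t ht a₀ ha₀ e₀ r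
  · rintro π' ⟨hπ', -, hconv'⟩
    obtain ⟨e₀⟩ := ‹Nonempty E›
    obtain ⟨Pr, Z, hPr, hZ, hM, he₀⟩ := exists_isMarkovChain p hp_sum e₀
    let a : ℕ → (ℕ → E → E) → ℝ := fun t ω =>
      Nat.rec abot (fun t b => f b (Z t ω)) t
    have habot : abot ∈ Icc abot abar := left_mem_Icc.2 habar.1.1
    refine Measure.ext_of_Iic _ _ fun r => ?_
    rw [← ENNReal.toReal_eq_toReal_iff' (measure_ne_top _ _) (measure_ne_top _ _)]
    refine eq_of_abs_sub_le_all fun ε hε => ?_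
    obtain ⟨t₀, ht₀⟩ := hconv (ε / 2) (half_pos hε)
    obtain ⟨t₁, ht₁⟩ := hconv' _ Pr hPr Z hZ hM e₀ he₀ abot habot a (fun _ => rfl)
      (fun _ _ => rfl) (ε / 2) (half_pos hε)
    have h := ht₀ (max t₀ t₁) (le_max_left _ _) abot habot e₀ r
    have h' := ht₁ (max t₀ t₁) (le_max_right _ _) r
    rw [← measureReal_def, hM.measureReal_le_eq_iterate hZ he₀ (a := a) (fun _ => rfl)
      (fun _ _ => rfl)] at h'
    rw [abs_le] at h h' ⊢
    constructor <;> linarith [h.1, h.2, h'.1, h'.2]
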